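/- arXiv:2105.11810 — 3 statements merged into one kernel-verified Lean document; each statement's English description precedes it below -/
import Mathlib

section
/- Let B be a subset of ℝ that is simultaneously a Bernstein set and a proper subgroup of (ℝ, +), let U₁ be a finite union of cosets of B, and let U₂ be a finite union of Vitali selectors of ℝ (each related to some countable dense subgroup of (ℝ, +)). Then the set U₁ ∪ U₂ contains no Lebesgue measurable set of positive Lebesgue measure; equivalently, every Lebesgue measurable subset of U₁ ∪ U₂ has Lebesgue measure zero. -/
open MeasureTheory

/-- A Bernstein set: a set `B ⊆ ℝ` such that every uncountable closed subset
`F` of `ℝ` meets both `B` and its complement. -/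
def IsBernstein (B : Set ℝ) : Prop :=
  ∀ F : Set ℝ, IsClosed F → ¬F.Countable → (F ∩ B).Nonempty ∧ (F ∩ Bᶜ).Nonempty

/-- `U` is a finite union of cosets (translates) of `B`. -/
def FinUnionCosets (B U : Set ℝ) : Prop :=
  ∃ (m : ℕ) (x : Fin (m + 1) → ℝ), U = ⋃ i, (fun b => b + x i) '' B

/-- `V` is a Vitali selector related to the subgroup `Q` of `(ℝ, +)`:
`V` contains exactly one point from each coset of `Q`. -/
def IsVitaliSelector (Q : AddSubgroup ℝ) (V : Set ℝ) : Prop :=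
  ∀ x : ℝ, ∃! v : ℝ, v ∈ V ∧ x - v ∈ Q

/-- `U` is a finite union of Vitali selectors, each related to some countable
dense subgroup of `(ℝ, +)`. -/
def FinUnionVitaliSelectors (U : Set ℝ) : Prop :=
  ∃ (n : ℕ) (V : Fin (n + 1) → Set ℝ) (Q : Fin (n + 1) → AddSubgroup ℝ),
    (∀ i, ((Q i : Set ℝ)).Countable ∧ Dense ((Q i : Set ℝ)) ∧
      IsVitaliSelector (Q i) (V i)) ∧ U = ⋃ i, V i

open scoped Pointwise

/-- Finitely many cosets of a proper subgroup of `ℝ` do not cover `ℝ`. -/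
lemma AddSubgroup.exists_forall_sub_notMem_of_ne_top {G : AddSubgroup ℝ} (hG : G ≠ ⊤)
    {ι : Type*} [Finite ι] (t : ι → ℝ) : ∃ z : ℝ, ∀ i, z - t i ∉ G := by
  by_contra! h
  apply hG
  have hfin : Finite (ℝ ⧸ G) := by
    refine Finite.of_surjective (fun i => (t i : ℝ ⧸ G)) fun w => ?_
    obtain ⟨z, rfl⟩ := QuotientAddGroup.mk_surjective w
    obtain ⟨i, hi⟩ := h z
    refine ⟨i, QuotientAddGroup.eq.2 ?_⟩
    rwa [neg_add_eq_sub]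
  have hfi : G.FiniteIndex := AddSubgroup.finiteIndex_of_finite_quotient
  refine (AddSubgroup.eq_top_iff' G).2 fun x => ?_
  have hne : (G.index : ℝ) ≠ 0 := Nat.cast_ne_zero.2 hfi.index_ne_zero
  have hmem := G.nsmul_index_mem (x / G.index)
  rwa [nsmul_eq_mul, mul_div_cancel₀ _ hne] at hmem

/-- A compact set of positive measure meets any `N` sufficiently small translates of itself
in a set of positive measure. -/
lemma IsCompact.exists_forall_volume_iInter_translate_pos {K : Set ℝ} (hK : IsCompact K)
    (hpos : volume K ≠ 0) (ι : Type*) [Fintype ι] :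
    ∃ δ > 0, ∀ s : ι → ℝ, (∀ i, |s i| < δ) →
      volume (K ∩ ⋂ i, (fun x => x + s i) ⁻¹' K) ≠ 0 := by
  have hfin : volume K ≠ ⊤ := hK.measure_lt_top.ne
  have hlim := tendsto_measure_vadd_sdiff_isCompact_isClosed (μ := (volume : Measure ℝ))
    hK hK.isClosed
  have hc : (0 : ENNReal) < volume K / (Fintype.card ι + 1 : ℕ) :=
    ENNReal.div_pos hpos (ENNReal.natCast_ne_top _)
  obtain ⟨δ, hδ, hball⟩ := Metric.eventually_nhds_iff.1 (hlim.eventually_lt_const hc)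
  refine ⟨δ, hδ, fun s hs h0 => ?_⟩
  have hdiff (i : ι) : volume (K \ (fun x => x + s i) ⁻¹' K)
      ≤ volume K / (Fintype.card ι + 1 : ℕ) := by
    have hlt := hball (y := s i) (by simpa [Real.dist_eq] using hs i)
    refine le_trans (le_of_eq ?_) hlt.le
    rw [← measure_preimage_add_right volume (s i) ((s i +ᵥ K) \ K)]
    congr 1
    ext x
    simp [Set.mem_vadd_set_iff_neg_vadd_mem]
  have hcover : K ⊆ (K ∩ ⋂ i, (fun x => x + s i) ⁻¹' K) ∪
      ⋃ i, K \ (fun x => x + s i) ⁻¹' K := by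
    intro x hx
    by_cases h : ∀ i, x + s i ∈ K
    · exact Or.inl ⟨hx, Set.mem_iInter.2 h⟩
    · push Not at h
      obtain ⟨i, hi⟩ := h
      exact Or.inr (Set.mem_iUnion.2 ⟨i, hx, hi⟩)
  have hle : volume K ≤ Fintype.card ι * (volume K / (Fintype.card ι + 1 : ℕ)) :=
    calc volume K ≤ _ := measure_mono hcover
      _ ≤ 0 + ∑ i, volume (K \ (fun x => x + s i) ⁻¹' K) :=
        (measure_union_le _ _).trans (add_le_add h0.le (measure_iUnion_fintype_le _ _))
      _ ≤ ∑ _i : ι, volume K / (Fintype.card ι + 1 : ℕ) := by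
        rw [zero_add]; exact Finset.sum_le_sum fun i _ => hdiff i
      _ = _ := by simp
  have hlt : Fintype.card ι * (volume K / (Fintype.card ι + 1 : ℕ)) < volume K := by
    have htop : volume K / (Fintype.card ι + 1 : ℕ) ≠ ⊤ :=
      ENNReal.div_ne_top hfin (by simp)
    calc Fintype.card ι * (volume K / (Fintype.card ι + 1 : ℕ))
        < Fintype.card ι * (volume K / (Fintype.card ι + 1 : ℕ))
          + volume K / (Fintype.card ι + 1 : ℕ) :=
          ENNReal.lt_add_right (ENNReal.mul_ne_top (by simp) htop) hc.ne'
      _ = (Fintype.card ι + 1 : ℕ) * (volume K / (Fintype.card ι + 1 : ℕ)) := by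
          push_cast; ring
      _ = volume K := ENNReal.mul_div_cancel (by simp) (by simp)
  exact (hle.trans_lt hlt).false

/-- A dense subgroup of `ℝ` contains any finite number of distinct, arbitrarily small elements. -/
lemma AddSubgroup.exists_injective_fin_abs_lt {Q : AddSubgroup ℝ} (hQ : Dense (Q : Set ℝ))
    (k : ℕ) {ε : ℝ} (hε : 0 < ε) :
    ∃ q : Fin k → ℝ, q.Injective ∧ ∀ j, q j ∈ Q ∧ |q j| < ε := by
  obtain ⟨x, hxQ, hx0, hx⟩ := hQ.exists_between (show (0 : ℝ) < ε / (k + 1) by positivity)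
  refine ⟨fun j => (j : ℕ) • x, fun a b hab => ?_, fun j => ⟨Q.nsmul_mem hxQ _, ?_⟩⟩
  · simpa [hx0.ne', Fin.ext_iff] using hab
  · rw [lt_div_iff₀ (by positivity)] at hx
    have hj : ((j : ℕ) : ℝ) ≤ k := by exact_mod_cast j.2.le
    simp only [nsmul_eq_mul]
    rw [abs_of_nonneg (by positivity)]
    nlinarith

/-- If the grid `[k]ⁿ⁺¹` is covered by sets `C i`, each meeting every line in direction `i` in at
most one point, then `k ≤ n + 1`. -/
lemma le_of_grid_cover {n k : ℕ} (C : Fin (n + 1) → Set (Fin (n + 1) → Fin k))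
    (hC : ∀ i, Set.InjOn i.removeNth (C i)) (hcover : ∀ p, ∃ i, p ∈ C i) : k ≤ n + 1 := by
  classical
  rcases Nat.eq_zero_or_pos k with rfl | hk
  · omega
  have hcard (i : Fin (n + 1)) : (Finset.univ.filter (· ∈ C i)).card ≤ k ^ n := by
    have h := Finset.card_le_card_of_injOn (s := Finset.univ.filter (· ∈ C i))
      (t := (Finset.univ : Finset (Fin n → Fin k))) i.removeNth (by simp)
      ((hC i).mono fun p hp => by simpa using hp)
    simpa using h
  have huniv : (Finset.univ : Finset (Fin (n + 1) → Fin k)) ⊆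
      Finset.univ.biUnion fun i => Finset.univ.filter (· ∈ C i) := fun p _ => by
    simpa using hcover p
  have hle := (Finset.card_le_card huniv).trans
    (Finset.card_biUnion_le_card_mul _ _ (k ^ n) fun i _ => hcard i)
  simp only [Finset.card_univ, Fintype.card_fun, Fintype.card_fin, pow_succ'] at hle
  exact Nat.le_of_mul_le_mul_right hle (by positivity)

/-- Two points of a Vitali selector that differ by an element of the subgroup are equal. -/
lemma IsVitaliSelector.eq_of_sub_mem {Q : AddSubgroup ℝ} {V : Set ℝ} (hV : IsVitaliSelector Q V)
    {v w : ℝ} (hv : v ∈ V) (hw : w ∈ V) (h : v - w ∈ Q) : v = w :=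
  (hV v).unique ⟨hv, by simp⟩ ⟨hw, h⟩

/-- A coset of a Bernstein subgroup meets every closed set of positive measure. -/
lemma IsBernstein.exists_add_mem {B : Set ℝ} (hB : IsBernstein B) {F : Set ℝ} (hF : IsClosed F)
    (hpos : volume F ≠ 0) (z : ℝ) : ∃ b ∈ B, b + z ∈ F := by
  have hpre : volume ((fun x => x + z) ⁻¹' F) ≠ 0 := by
    rwa [measure_preimage_add_right]
  obtain ⟨b, hbF, hbB⟩ := (hB _ (hF.preimage (continuous_add_const z))
    fun hc => hpre (hc.measure_zero _)).1
  exact ⟨b, hbB, hbF⟩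

theorem stmt_17 (B : Set ℝ) (hB : IsBernstein B)
    (hsub : ∃ G : AddSubgroup ℝ, (G : Set ℝ) = B ∧ G ≠ ⊤)
    (U₁ U₂ : Set ℝ) (hU₁ : FinUnionCosets B U₁) (hU₂ : FinUnionVitaliSelectors U₂) :
    ∀ Y : Set ℝ, Y ⊆ U₁ ∪ U₂ → NullMeasurableSet Y volume → volume Y = 0 := by
  intro Y hY hmeas
  by_contra hpos
  obtain ⟨G, rfl, hG⟩ := hsub
  obtain ⟨m, x, rfl⟩ := hU₁
  obtain ⟨n, V, Q, hVQ, rfl⟩ := hU₂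
  obtain ⟨Z, hZY, hZ, hZae⟩ := hmeas.exists_measurable_subset_ae_eq
  have hZpos : 0 < volume Z := by
    rw [measure_congr hZae]; exact pos_iff_ne_zero.2 hpos
  obtain ⟨K, hKZ, hK, hKpos⟩ := hZ.exists_lt_isCompact hZpos
  obtain ⟨δ, hδ, hgrid⟩ := hK.exists_forall_volume_iInter_translate_pos hKpos.ne'
    (Fin (n + 1) → Fin (n + 2))
  choose q hqinj hq using fun i => AddSubgroup.exists_injective_fin_abs_lt (hVQ i).2.1 (n + 2)
    (show (0 : ℝ) < δ / (n + 1) by positivity)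
  let s : (Fin (n + 1) → Fin (n + 2)) → ℝ := fun p => ∑ i, q i (p i)
  have hs (p) : |s p| < δ :=
    calc |s p| ≤ ∑ i, |q i (p i)| := Finset.abs_sum_le_sum_abs _ _
      _ < ∑ _i : Fin (n + 1), δ / (n + 1) :=
        Finset.sum_lt_sum_of_nonempty Finset.univ_nonempty fun i _ => (hq i (p i)).2
      _ = δ := by simp; field_simp
  obtain ⟨z, hz⟩ := AddSubgroup.exists_forall_sub_notMem_of_ne_top hG
    fun r : Fin (m + 1) × (Fin (n + 1) → Fin (n + 2)) => x r.1 - s r.2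
  have hclosed : IsClosed (K ∩ ⋂ p, (fun y => y + s p) ⁻¹' K) :=
    hK.isClosed.inter (isClosed_iInter fun p => hK.isClosed.preimage (continuous_add_const _))
  obtain ⟨g, hgG, hg⟩ := hB.exists_add_mem hclosed (hgrid s hs) z
  have hV (p) : ∃ i, g + z + s p ∈ V i := by
    rcases hY (hZY (hKZ (Set.mem_iInter.1 hg.2 p))) with h | h
    · obtain ⟨i, b, hb, hbx⟩ := Set.mem_iUnion.1 h
      refine absurd ?_ (hz (i, p))
      have heq : z - (x i - s p) = b - g := by
        simp only at hbx
        linarith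
      simpa only [heq] using G.sub_mem hb hgG
    · exact Set.mem_iUnion.1 h
  have hle := le_of_grid_cover (fun i => {p | g + z + s p ∈ V i}) (fun i p hp p' hp' h => ?_) hV
  · omega
  have hsucc (j) : p (i.succAbove j) = p' (i.succAbove j) := congrFun h j
  have hdiff : g + z + s p - (g + z + s p') = q i (p i) - q i (p' i) := by
    simp only [s, Fin.sum_univ_succAbove _ i, hsucc]
    ring
  have heq := (hVQ i).2.2.eq_of_sub_mem hp hp'
    (hdiff ▸ (Q i).sub_mem (hq i (p i)).1 (hq i (p' i)).1)
  have hi : p i = p' i := hqinj i (by linarith)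
  funext j
  rcases Fin.eq_self_or_eq_succAbove i j with rfl | ⟨j, rfl⟩
  · exact hi
  · exact hsucc j
end

section
/- Let B be a subset of ℝ that is simultaneously a Bernstein set and a proper subgroup of (ℝ, +). Then for every finite union U₂ of cosets of B, every finite union U₁ of Vitali selectors of ℝ (each related to some countable dense subgroup of (ℝ, +)), and all sets M, N ⊆ ℝ of Lebesgue measure zero, the set (((U₁ ∪ U₂) \ M) ∪ N) is not Lebesgue measurable; in particular U₁ ∪ U₂ itself is not Lebesgue measurable. -/
open MeasureTheory

/-- A null measurable set disjoint from a translate of a Bernstein set is null. -/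
theorem IsBernstein.measure_eq_zero_of_disjoint_translate {B A : Set ℝ} (hB : IsBernstein B)
    (hA : NullMeasurableSet A volume) (y : ℝ) (h : ∀ b ∈ B, b + y ∉ A) : volume A = 0 := by
  by_contra hpos
  obtain ⟨A', hA'A, hA'meas, hA'eq⟩ := hA.exists_measurable_subset_ae_eq
  have hA' : 0 < volume A' := by
    rw [measure_congr hA'eq]
    exact pos_iff_ne_zero.mpr hpos
  obtain ⟨K, hKA, hK, hKpos⟩ := hA'meas.exists_lt_isCompact hA'
  have hcl : IsClosed ((fun b : ℝ => b + y) ⁻¹' K) := hK.isClosed.preimage (by fun_prop)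
  have hunc : ¬((fun b : ℝ => b + y) ⁻¹' K).Countable := by
    intro hc
    have h0 := hc.measure_zero volume
    rw [measure_preimage_add_right] at h0
    exact hKpos.ne' h0
  obtain ⟨b, hbK, hbB⟩ := (hB _ hcl hunc).1
  exact h b hbB (hA'A (hKA hbK))

/-- Finitely many cosets of a proper subgroup do not cover the real line. -/
theorem AddSubgroup.exists_forall_sub_notMem_of_finite {G : AddSubgroup ℝ} (hG : G ≠ ⊤)
    {F : Set ℝ} (hF : F.Finite) : ∃ y, ∀ f ∈ F, y - f ∉ G := by
  by_contra! hcov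
  have : Finite (ℝ ⧸ G) := by
    have := hF.to_subtype
    refine Finite.of_surjective (fun f : F => (QuotientAddGroup.mk (f : ℝ) : ℝ ⧸ G)) ?_
    intro q
    induction q using QuotientAddGroup.induction_on with
    | H z =>
      obtain ⟨f, hf, hzf⟩ := hcov z
      refine ⟨⟨f, hf⟩, QuotientAddGroup.eq.mpr ?_⟩
      rwa [neg_add_eq_sub]
  have hidx : (G.index : ℝ) ≠ 0 := by
    have : G.index ≠ 0 := AddSubgroup.index_ne_zero_of_finite
    exact_mod_cast this
  refine hG (eq_top_iff.mpr fun x _ => ?_)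
  have hx := G.nsmul_index_mem (x / G.index)
  rwa [nsmul_eq_mul, mul_div_cancel₀ _ hidx] at hx

/-- For finitely many Vitali selectors, there is a finite set of translations such that every point
can be moved out of all the selectors by one of them. -/
theorem exists_finset_forall_add_notMem_iUnion (n : ℕ) (V : Fin n → Set ℝ)
    (Q : Fin n → AddSubgroup ℝ)
    (h : ∀ i, Dense (Q i : Set ℝ) ∧ IsVitaliSelector (Q i) (V i)) :
    ∃ T : Finset ℝ, ∀ x : ℝ, ∃ t ∈ T, x + t ∉ ⋃ i, V i := by
  classical
  induction n with
  | zero => exact ⟨{0}, fun x => ⟨0, by simp, by simp⟩⟩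
  | succ n ih =>
    obtain ⟨T, hT⟩ := ih (fun i => V i.succ) (fun i => Q i.succ) (fun i => h i.succ)
    obtain ⟨q, hq, hq0⟩ := (h 0).1.exists_mem_open isOpen_Ioi (Set.nonempty_Ioi (a := (0 : ℝ)))
    refine ⟨(Finset.range (T.card + 1) ×ˢ T).image fun p => (p.1 : ℝ) * q + p.2, fun x => ?_⟩
    choose f hfT hf using fun j : ℕ => hT (x + j * q)
    obtain ⟨j, hj, k, hk, hjk, hfjk⟩ := Finset.exists_ne_map_eq_of_card_lt_of_maps_to
      (s := Finset.range (T.card + 1)) (t := T) (by simp) (f := f) (fun j _ => hfT j)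
    by_contra! hcon
    have key : ∀ i ∈ Finset.range (T.card + 1), x + (i * q + f i) ∈ V 0 := by
      intro i hi
      have hmem := hcon (i * q + f i)
        (Finset.mem_image.mpr ⟨(i, f i), Finset.mem_product.mpr ⟨hi, hfT i⟩, rfl⟩)
      obtain ⟨l, hl⟩ := Set.mem_iUnion.mp hmem
      cases l using Fin.cases with
      | zero => exact hl
      | succ l =>
        refine absurd (Set.mem_iUnion.mpr ⟨l, ?_⟩) (hf i)
        rwa [add_assoc]
    have hdiff : x + (j * q + f j) - (x + (k * q + f k)) ∈ Q 0 := by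
      have : x + (j * q + f j) - (x + (k * q + f k)) = j • q - k • q := by
        rw [hfjk, nsmul_eq_mul, nsmul_eq_mul]
        ring
      rw [this]
      exact sub_mem (nsmul_mem hq j) (nsmul_mem hq k)
    have heq := ((h 0).2 (x + (j * q + f j))).unique ⟨key j hj, by simp⟩ ⟨key k hk, hdiff⟩
    rw [hfjk] at heq
    have hmul : (j : ℝ) * q = k * q := by linarith
    exact hjk (by exact_mod_cast mul_right_cancel₀ (ne_of_gt hq0) hmul)

/-- The union of finitely many Vitali selectors and finitely many cosets of a proper subgroup
that is a Bernstein set is not Lebesgue measurable. -/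
theorem not_nullMeasurableSet_union {G : AddSubgroup ℝ} (hG : G ≠ ⊤)
    (hB : IsBernstein (G : Set ℝ)) {U₁ U₂ : Set ℝ} (hU₂ : FinUnionCosets (G : Set ℝ) U₂)
    (hU₁ : FinUnionVitaliSelectors U₁) : ¬NullMeasurableSet (U₁ ∪ U₂) volume := by
  intro hU
  obtain ⟨m, x, rfl⟩ := hU₂
  obtain ⟨n, V, Q, hV, rfl⟩ := hU₁
  set Z := ((⋃ i, V i) ∪ ⋃ i, (fun b => b + x i) '' (G : Set ℝ))ᶜ with hZ
  have hZ0 : volume Z = 0 := hB.measure_eq_zero_of_disjoint_translate hU.compl (x 0)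
    fun b hb hbZ => hbZ (Or.inr (Set.mem_iUnion.mpr ⟨0, b, hb, rfl⟩))
  obtain ⟨T, hT⟩ := exists_finset_forall_add_notMem_iUnion (n + 1) V Q fun i => (hV i).2
  obtain ⟨y, hy⟩ := AddSubgroup.exists_forall_sub_notMem_of_finite hG
    ((Set.finite_range x).image2 (fun a t => a - t) T.finite_toSet)
  set W := ⋃ t ∈ T, (fun z => z + t) ⁻¹' Z
  have hW : volume W = 0 := by
    refine (measure_biUnion_null_iff T.countable_toSet).mpr fun t _ => ?_
    rwa [measure_preimage_add_right]
  have hWc : volume Wᶜ = 0 := by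
    refine hB.measure_eq_zero_of_disjoint_translate (NullMeasurableSet.of_null hW).compl y ?_
    intro b hb hbW
    obtain ⟨t, ht, hbt⟩ := hT (b + y)
    refine hbW (Set.mem_biUnion ht ?_)
    rintro (h | h)
    · exact hbt h
    · obtain ⟨i, c, hc, hci⟩ := Set.mem_iUnion.mp h
      refine hy _ (Set.mem_image2_of_mem ⟨i, rfl⟩ ht) ?_
      have : y - (x i - t) = c - b := by
        simp only at hci
        linarith
      rw [this]
      exact sub_mem hc hb
  have huniv : volume (Set.univ : Set ℝ) = 0 := by
    rw [← Set.union_compl_self W]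
    exact measure_union_null hW hWc
  simp at huniv

theorem stmt_18 (B : Set ℝ) (hB : IsBernstein B)
    (hsub : ∃ G : AddSubgroup ℝ, (G : Set ℝ) = B ∧ G ≠ ⊤)
    (U₂ : Set ℝ) (hU₂ : FinUnionCosets B U₂)
    (U₁ : Set ℝ) (hU₁ : FinUnionVitaliSelectors U₁)
    (M N : Set ℝ) (hM : volume M = 0) (hN : volume N = 0) :
    ¬NullMeasurableSet (((U₁ ∪ U₂) \ M) ∪ N) volume ∧
    ¬NullMeasurableSet (U₁ ∪ U₂) volume := by
  obtain ⟨G, rfl, hG⟩ := hsub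
  have hU := not_nullMeasurableSet_union hG hB hU₂ hU₁
  refine ⟨fun h => hU (h.congr ?_), hU⟩
  exact (union_ae_eq_left_of_ae_eq_empty (ae_eq_empty.mpr hN)).trans
    (sdiff_null_ae_eq_self hM)
end

section
/- Let B₁ and B₂ be subsets of ℝ, each simultaneously a Bernstein set and a proper subgroup of (ℝ, +). Let U₁ be a finite union of cosets of B₁, U₂ a finite union of cosets of B₂, and U₃ a finite union of Vitali selectors of ℝ (each related to some countable dense subgroup of (ℝ, +)). Then for all sets N, M ⊆ ℝ of Lebesgue measure zero, the set (((U₁ ∪ U₂ ∪ U₃) \ N) ∪ M) is not Lebesgue measurable; in particular U₁ ∪ U₂ ∪ U₃ itself is not Lebesgue measurable and contains no Lebesgue measurable set of positive measure. -/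
open MeasureTheory

/-- `S` is sparse if there are finite families of arbitrarily small translations such that, whatever
the base point, only an arbitrarily small proportion of the translated points lies in `S`. -/
def IsSparse (S : Set ℝ) : Prop :=
  ∀ δ > (0 : ℝ), ∀ k : ℕ, ∃ (ι : Type) (_ : Fintype ι) (_ : Nonempty ι) (f : ι → ℝ),
    (∀ i, |f i| < δ) ∧ ∀ y, k * {i | y + f i ∈ S}.ncard ≤ Fintype.card ι

theorem isSparse_of_progression {S : Set ℝ}
    (h : ∀ δ > (0 : ℝ), ∀ n : ℕ, ∃ w : ℝ, n * |w| < δ ∧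
      ∀ y : ℝ, ∀ i j : ℕ, i < n → j < n → y + i * w ∈ S → y + j * w ∈ S → i = j) :
    IsSparse S := by
  intro δ hδ k
  obtain ⟨w, hw, hS⟩ := h δ hδ (k + 1)
  refine ⟨Fin (k + 1), inferInstance, inferInstance, fun i => (i : ℕ) * w, fun i => ?_, fun y => ?_⟩
  · rw [abs_mul, Nat.abs_cast]
    refine lt_of_le_of_lt (mul_le_mul_of_nonneg_right ?_ (abs_nonneg w)) hw
    exact_mod_cast i.2.le
  · have : {i : Fin (k + 1) | y + (i : ℕ) * w ∈ S}.ncard ≤ 1 :=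
      (Set.ncard_le_one_iff (Set.toFinite _)).2 fun ha hb => Fin.ext (hS y _ _ (Fin.is_lt _) (Fin.is_lt _) ha hb)
    calc k * _ ≤ k * 1 := Nat.mul_le_mul_left k this
      _ ≤ _ := by simp

theorem ncard_setOf_prod_le {ι κ : Type*} [Fintype ι] [Fintype κ] (p : ι → κ → Prop) (k c : ℕ)
    (h : ∀ j, k * {i | p i j}.ncard ≤ c) :
    k * {q : ι × κ | p q.1 q.2}.ncard ≤ c * Fintype.card κ := by
  classical
  have : {q : ι × κ | p q.1 q.2}.ncard = ∑ j, {i | p i j}.ncard := by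
    simp only [Set.ncard_eq_toFinset_card', Set.toFinset_ofPred, Finset.card_filter,
      Fintype.sum_prod_type_right]
  rw [this, Finset.mul_sum]
  exact (Finset.sum_le_sum fun j _ => h j).trans (by simp [mul_comm])

theorem IsSparse.union {S T : Set ℝ} (hS : IsSparse S) (hT : IsSparse T) : IsSparse (S ∪ T) := by
  intro δ hδ k
  obtain ⟨ι, _, _, f, hf, hfS⟩ := hS (δ / 2) (half_pos hδ) (2 * k)
  obtain ⟨κ, _, _, g, hg, hgT⟩ := hT (δ / 2) (half_pos hδ) (2 * k)
  refine ⟨ι × κ, inferInstance, inferInstance, fun q => f q.1 + g q.2, fun q => ?_, fun y => ?_⟩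
  · exact (abs_add_le _ _).trans_lt (by linarith [hf q.1, hg q.2])
  · have h₁ := ncard_setOf_prod_le (fun i j => y + (f i + g j) ∈ S) (2 * k) (Fintype.card ι)
      fun j => by simpa only [add_assoc, add_comm (g j)] using hfS (y + g j)
    have h₂ := ncard_setOf_prod_le (fun j i => y + (f i + g j) ∈ T) (2 * k) (Fintype.card κ)
      fun i => by simpa only [add_assoc] using hgT (y + f i)
    have h₃ : {q : κ × ι | y + (f q.2 + g q.1) ∈ T}.ncard
        = {q : ι × κ | y + (f q.1 + g q.2) ∈ T}.ncard := by
      rw [← Set.ncard_image_of_injective _ (Equiv.prodComm κ ι).injective]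
      congr 1
      ext ⟨i, j⟩
      simp
    have h₄ : {q : ι × κ | y + (f q.1 + g q.2) ∈ S ∪ T}.ncard
        ≤ {q : ι × κ | y + (f q.1 + g q.2) ∈ S}.ncard
          + {q : ι × κ | y + (f q.1 + g q.2) ∈ T}.ncard := Set.ncard_union_le _ _
    rw [h₃] at h₂
    rw [Fintype.card_prod]
    nlinarith [Nat.mul_le_mul_left k h₄]

theorem isSparse_empty : IsSparse ∅ :=
  isSparse_of_progression fun δ hδ n => ⟨0, by simpa using hδ, by simp⟩

theorem isSparse_iUnion {ι : Type*} [Finite ι] {S : ι → Set ℝ} (h : ∀ i, IsSparse (S i)) :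
    IsSparse (⋃ i, S i) := by
  have key : ∀ s : Set ι, s.Finite → IsSparse (⋃ i ∈ s, S i) := fun s hs => by
    induction s, hs using Set.Finite.induction_on with
    | empty => simpa using isSparse_empty
    | insert _ _ ih => rw [Set.biUnion_insert]; exact (h _).union ih
  simpa using key Set.univ Set.finite_univ

theorem IsSparse.volume_eq_zero {S Y : Set ℝ} (hS : IsSparse S) (hYS : Y ⊆ S)
    (hY : NullMeasurableSet Y volume) : volume Y = 0 := by
  by_contra hpos
  obtain ⟨Z, hZY, hZ, hZe⟩ := hY.exists_measurable_subset_ae_eq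
  have hZpos : 0 < volume Z := by rw [measure_congr hZe]; exact pos_iff_ne_zero.2 hpos
  obtain ⟨K, hKZ, hK, hKpos⟩ := hZ.exists_lt_isCompact hZpos
  have hKtop : volume K ≠ ⊤ := hK.measure_lt_top.ne
  obtain ⟨W, hKW, hW, hWlt⟩ := K.exists_isOpen_lt_of_lt (2 * volume K)
    (by simpa [two_mul] using ENNReal.lt_add_right hKtop hKpos.ne')
  obtain ⟨δ, hδ, hδW⟩ := hK.exists_thickening_subset_open hW hKW
  obtain ⟨ι, _, _, f, hf, hfS⟩ := hS δ hδ 2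
  have hsub : ∀ i y, y + f i ∈ K → y ∈ W := fun i y hy =>
    hδW (Metric.mem_thickening_iff.2 ⟨_, hy, by simpa [Real.dist_eq] using hf i⟩)
  have hvol : ∀ i, ∫⁻ y, K.indicator (1 : ℝ → ENNReal) (y + f i) = volume K := fun i => by
    rw [lintegral_add_right_eq_self (K.indicator (1 : ℝ → ENNReal)) (f i)]
    exact lintegral_indicator_one hK.measurableSet
  have hpt : ∀ y, 2 * ∑ i, K.indicator (1 : ℝ → ENNReal) (y + f i)
      ≤ W.indicator (fun _ => (Fintype.card ι : ENNReal)) y := fun y => by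
    classical
    by_cases hy : y ∈ W
    · have hcount : ∑ i, K.indicator (1 : ℝ → ENNReal) (y + f i)
          = ({i | y + f i ∈ K}.ncard : ENNReal) := by
        simp [Set.indicator_apply, Set.ncard_eq_toFinset_card']
      have hle : {i | y + f i ∈ K}.ncard ≤ {i | y + f i ∈ S}.ncard :=
        Set.ncard_le_ncard fun i hi => hYS (hZY (hKZ hi))
      rw [hcount, Set.indicator_of_mem hy]
      exact_mod_cast (Nat.mul_le_mul_left 2 hle).trans (hfS y)
    · have : ∀ i, y + f i ∉ K := fun i hi => hy (hsub i y hi)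
      simp [this]
  have hmeas : ∀ i, Measurable fun y => K.indicator (1 : ℝ → ENNReal) (y + f i) := fun i =>
    (measurable_one.indicator hK.measurableSet).comp (measurable_add_const (f i))
  have hint := lintegral_mono (μ := volume) hpt
  rw [lintegral_const_mul _ (Finset.measurable_fun_sum _ fun i _ => hmeas i),
    lintegral_finsetSum _ fun i _ => hmeas i, lintegral_indicator_const hW.measurableSet] at hint
  simp only [hvol, Finset.sum_const, Finset.card_univ, nsmul_eq_mul] at hint
  rw [mul_left_comm] at hint
  exact hWlt.not_ge ((ENNReal.mul_le_mul_iff_right (by simp) (by simp)).1 hint)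

theorem isSparse_coset {G : AddSubgroup ℝ} (hG : G ≠ ⊤) (x : ℝ) :
    IsSparse ((fun b => b + x) '' (G : Set ℝ)) := by
  obtain ⟨z, hz⟩ : ∃ z, z ∉ G := by
    by_contra! h
    exact hG (AddSubgroup.ext (by simpa using h))
  refine isSparse_of_progression fun δ hδ n => ?_
  obtain ⟨M, hM⟩ := exists_nat_gt (n * |z| / δ)
  have hM0 : (0 : ℝ) < M := lt_of_le_of_lt (by positivity) hM
  have hfac : (1 : ℝ) ≤ n.factorial := by exact_mod_cast n.factorial_pos
  set w := z / (n.factorial * M) with hw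
  have hdiff : ∀ d : ℕ, 0 < d → d < n → (d : ℝ) * w ∉ G := fun d hd hdn hmem => by
    obtain ⟨e, he⟩ := Nat.dvd_factorial hd hdn.le
    have hez : z = (e * M : ℕ) • ((d : ℝ) * w) := by
      have hc : (n.factorial : ℝ) = d * e := by exact_mod_cast he
      have : z = (n.factorial * M : ℝ) * w := by rw [hw]; field_simp
      rw [nsmul_eq_mul]
      push_cast
      rw [this, hc]
      ring
    exact hz (hez ▸ G.nsmul_mem hmem _)
  have hlt : ∀ y : ℝ, ∀ i j : ℕ, i < j → j < n → y + i * w ∈ (fun b => b + x) '' (G : Set ℝ) →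
      y + j * w ∉ (fun b => b + x) '' (G : Set ℝ) := by
    rintro y i j hij hj ⟨a, ha, hay⟩ ⟨b, hb, hby⟩
    refine hdiff (j - i) (by omega) (by omega) ?_
    have : ((j - i : ℕ) : ℝ) * w = b - a := by
      rw [Nat.cast_sub hij.le]
      linear_combination hay - hby
    exact this ▸ G.sub_mem hb ha
  refine ⟨w, ?_, fun y i j hi hj hyi hyj => ?_⟩
  · rw [hw, abs_div, abs_of_pos (by positivity : (0 : ℝ) < n.factorial * M), ← mul_div_assoc,
      div_lt_iff₀ (by positivity)]
    rw [div_lt_iff₀ hδ] at hM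
    nlinarith [mul_pos hM0 hδ]
  · rcases lt_trichotomy i j with h | h | h
    · exact absurd hyj (hlt y i j h hj hyi)
    · exact h
    · exact absurd hyi (hlt y j i h hi hyj)

theorem IsVitaliSelector.isSparse {Q : AddSubgroup ℝ} {V : Set ℝ} (hV : IsVitaliSelector Q V)
    (hQ : Dense (Q : Set ℝ)) : IsSparse V := by
  refine isSparse_of_progression fun δ hδ n => ?_
  obtain ⟨w, hwQ, hw0, hw⟩ := hQ.exists_between (show (0 : ℝ) < δ / (n + 1) by positivity)
  refine ⟨w, ?_, fun y i j _ _ hi hj => ?_⟩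
  · rw [abs_of_pos hw0]
    rw [lt_div_iff₀ (by positivity)] at hw
    nlinarith
  · have hmem : (y + i * w) - (y + j * w) ∈ Q := by
      have : (y + i * w) - (y + j * w) = i • w - j • w := by simp only [nsmul_eq_mul]; ring
      exact this ▸ Q.sub_mem (Q.nsmul_mem hwQ _) (Q.nsmul_mem hwQ _)
    have := (hV (y + i * w)).unique ⟨hi, by simp⟩ ⟨hj, hmem⟩
    exact_mod_cast mul_right_cancel₀ hw0.ne' (add_left_cancel this)

theorem FinUnionCosets.isSparse {B U : Set ℝ} (hU : FinUnionCosets B U)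
    (hB : ∃ G : AddSubgroup ℝ, (G : Set ℝ) = B ∧ G ≠ ⊤) : IsSparse U := by
  obtain ⟨m, x, rfl⟩ := hU
  obtain ⟨G, rfl, hG⟩ := hB
  exact isSparse_iUnion fun i => isSparse_coset hG (x i)

theorem FinUnionVitaliSelectors.isSparse {U : Set ℝ} (hU : FinUnionVitaliSelectors U) :
    IsSparse U := by
  obtain ⟨n, V, Q, h, rfl⟩ := hU
  exact isSparse_iUnion fun i => (h i).2.2.isSparse (h i).2.1

theorem IsBernstein.volume_ne_zero {B : Set ℝ} (hB : IsBernstein B) : volume B ≠ 0 := by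
  intro h0
  have hpos : 0 < volume (toMeasurable volume B)ᶜ := by
    rw [measure_compl (measurableSet_toMeasurable _ _) (by simp [h0])]
    simp [h0]
  obtain ⟨K, hKB, hK, hKpos⟩ :=
    (measurableSet_toMeasurable volume B).compl.exists_lt_isCompact hpos
  obtain ⟨x, hxK, hxB⟩ := (hB K hK.isClosed fun hc => hKpos.ne' (hc.measure_zero volume)).1
  exact hKB hxK (subset_toMeasurable volume B hxB)

theorem FinUnionCosets.volume_ne_zero {B U : Set ℝ} (hU : FinUnionCosets B U)
    (hB : IsBernstein B) : volume U ≠ 0 := by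
  obtain ⟨m, x, rfl⟩ := hU
  intro h0
  have := measure_iUnion_null_iff.1 h0 0
  rw [Set.image_add_right, measure_preimage_add_right] at this
  exact hB.volume_ne_zero this

theorem stmt_19 (B₁ B₂ : Set ℝ)
    (hB₁ : IsBernstein B₁) (hB₂ : IsBernstein B₂)
    (hsub₁ : ∃ G : AddSubgroup ℝ, (G : Set ℝ) = B₁ ∧ G ≠ ⊤)
    (hsub₂ : ∃ G : AddSubgroup ℝ, (G : Set ℝ) = B₂ ∧ G ≠ ⊤)
    (U₁ U₂ U₃ : Set ℝ)
    (hU₁ : FinUnionCosets B₁ U₁) (hU₂ : FinUnionCosets B₂ U₂)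
    (hU₃ : FinUnionVitaliSelectors U₃)
    (N M : Set ℝ) (hN : volume N = 0) (hM : volume M = 0) :
    ¬NullMeasurableSet (((U₁ ∪ U₂ ∪ U₃) \ N) ∪ M) volume ∧
    ¬NullMeasurableSet (U₁ ∪ U₂ ∪ U₃) volume ∧
    ∀ Y : Set ℝ, Y ⊆ U₁ ∪ U₂ ∪ U₃ → NullMeasurableSet Y volume → volume Y = 0 := by
  have hsparse : IsSparse (U₁ ∪ U₂ ∪ U₃) :=
    ((hU₁.isSparse hsub₁).union (hU₂.isSparse hsub₂)).union hU₃.isSparse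
  have hnull : ¬NullMeasurableSet (U₁ ∪ U₂ ∪ U₃) volume := fun h =>
    hU₁.volume_ne_zero hB₁ (measure_mono_null
      (Set.subset_union_left.trans Set.subset_union_left)
      (hsparse.volume_eq_zero subset_rfl h))
  refine ⟨fun h => hnull (h.congr ?_), hnull, fun Y hYU hY => hsparse.volume_eq_zero hYU hY⟩
  exact (union_ae_eq_left_of_ae_eq_empty (ae_eq_empty.2 hM)).trans
    (sdiff_null_ae_eq_self hN)
end
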